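/- arXiv:2303.15154 — 11 statements merged into one kernel-verified Lean document; each statement's English description precedes it below -/
import Mathlib

section
/- Let I be a nonempty index set, (A_i)_{i∈I} a family of additive abelian groups, and c_{i,j}, d_{i,j} ∈ A_j constants for all i,j ∈ I. Define on the disjoint union X = ⨆_{i∈I} A_i the maps σ_x(y) = y + c_{i,j} and τ_y(x) = x + d_{j,i} for x ∈ A_i, y ∈ A_j. Then (X,σ,τ) is a 2-reductive solution of the Yang–Baxter equation: every σ_x and every τ_y is a bijection of X, the map r(x,y)=(σ_x(y),τ_y(x)) is bijective, the braid relation (id×r)(r×id)(id×r)=(r×id)(id×r)(r×id) holds, and for all x,y ∈ X one has σ_{σ_x(y)}=σ_y, τ_{τ_x(y)}=τ_y, σ_{τ_x(y)}=σ_y and τ_{σ_x(y)}=τ_y. -/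
namespace YBE

variable {X : Type*}

/-- The map `r(x,y) = (σ_x(y), τ_y(x))`. -/
def rmap (σ τ : X → X → X) : X × X → X × X :=
  fun p => (σ p.1 p.2, τ p.2 p.1)

/-- `r × id` acting on triples. -/
def r12 (σ τ : X → X → X) : X × X × X → X × X × X :=
  fun p => (σ p.1 p.2.1, τ p.2.1 p.1, p.2.2)

/-- `id × r` acting on triples. -/
def r23 (σ τ : X → X → X) : X × X × X → X × X × X :=
  fun p => (p.1, σ p.2.1 p.2.2, τ p.2.2 p.2.1)

/-- `(X, σ, τ)` is a (non-degenerate, set-theoretic) solution of the Yang–Baxter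
equation: all `σ_x` and `τ_y` are bijections, `r` is bijective, and the braid
relation `(id×r)(r×id)(id×r) = (r×id)(id×r)(r×id)` holds. -/
def IsSolution (σ τ : X → X → X) : Prop :=
  (∀ x, Function.Bijective (σ x)) ∧
  (∀ y, Function.Bijective (τ y)) ∧
  Function.Bijective (rmap σ τ) ∧
  r23 σ τ ∘ r12 σ τ ∘ r23 σ τ = r12 σ τ ∘ r23 σ τ ∘ r12 σ τ

/-- 2-reductivity: `σ_{σ_x(y)} = σ_y`, `τ_{τ_x(y)} = τ_y`, `σ_{τ_x(y)} = σ_y`,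
`τ_{σ_x(y)} = τ_y`. -/
def IsTwoReductive (σ τ : X → X → X) : Prop :=
  (∀ x y, σ (σ x y) = σ y) ∧ (∀ x y, τ (τ x y) = τ y) ∧
  (∀ x y, σ (τ x y) = σ y) ∧ (∀ x y, τ (σ x y) = τ y)

section DisjointUnion

variable {I : Type*} {A : I → Type*}

/-- The left translation of the disjoint-union solution:
`σ_x(y) = y + c_{i,j}` for `x ∈ A_i`, `y ∈ A_j`. -/
def duσ [∀ i, AddCommGroup (A i)] (c : ∀ i j : I, A j) :
    (Σ i, A i) → (Σ i, A i) → (Σ i, A i) :=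
  fun x y => ⟨y.1, y.2 + c x.1 y.1⟩

/-- The right translation of the disjoint-union solution:
`τ_y(x) = x + d_{j,i}` for `x ∈ A_i`, `y ∈ A_j`. -/
def duτ [∀ i, AddCommGroup (A i)] (d : ∀ i j : I, A j) :
    (Σ i, A i) → (Σ i, A i) → (Σ i, A i) :=
  fun y x => ⟨x.1, x.2 + d y.1 x.1⟩

end DisjointUnion

/-- A translation of the disjoint union that moves `A_j` by `t j` is bijective. -/
theorem bijective_sigma_translation {I : Type*} {A : I → Type*} [∀ i, AddCommGroup (A i)]
    (t : ∀ j, A j) :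
    Function.Bijective (fun y : Σ i, A i => (⟨y.1, y.2 + t y.1⟩ : Σ i, A i)) :=
  Function.bijective_iff_has_inverse.mpr
    ⟨fun y => ⟨y.1, y.2 - t y.1⟩, fun y => by simp, fun y => by simp⟩

theorem bijective_rmap_disjointUnion {I : Type*} {A : I → Type*} [∀ i, AddCommGroup (A i)]
    (c d : ∀ _ j : I, A j) : Function.Bijective (rmap (duσ c) (duτ d)) :=
  Function.bijective_iff_has_inverse.mpr
    ⟨fun p => (⟨p.2.1, p.2.2 - d p.1.1 p.2.1⟩, ⟨p.1.1, p.1.2 - c p.2.1 p.1.1⟩),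
      fun _ => Prod.ext (Sigma.ext rfl (heq_of_eq (add_sub_cancel_right _ _)))
        (Sigma.ext rfl (heq_of_eq (add_sub_cancel_right _ _))),
      fun _ => Prod.ext (Sigma.ext rfl (heq_of_eq (sub_add_cancel _ _)))
        (Sigma.ext rfl (heq_of_eq (sub_add_cancel _ _)))⟩

theorem braid_disjointUnion {I : Type*} {A : I → Type*} [∀ i, AddCommGroup (A i)]
    (c d : ∀ _ j : I, A j) :
    r23 (duσ c) (duτ d) ∘ r12 (duσ c) (duτ d) ∘ r23 (duσ c) (duτ d) =
      r12 (duσ c) (duτ d) ∘ r23 (duσ c) (duτ d) ∘ r12 (duσ c) (duτ d) := by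
  funext p
  simp only [Function.comp_apply, r12, r23, duσ, duτ, Prod.mk.injEq, Sigma.mk.injEq, heq_eq_eq,
    true_and]
  exact ⟨add_right_comm _ _ _, add_right_comm _ _ _, add_right_comm _ _ _⟩

theorem isTwoReductive_disjointUnion {I : Type*} {A : I → Type*} [∀ i, AddCommGroup (A i)]
    (c d : ∀ _ j : I, A j) : IsTwoReductive (duσ c) (duτ d) :=
  ⟨fun _ _ => rfl, fun _ _ => rfl, fun _ _ => rfl, fun _ _ => rfl⟩

/-- the disjoint union of abelian groups with translations
`σ_x(y) = y + c_{i,j}`, `τ_y(x) = x + d_{j,i}` is a 2-reductive solution of the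
Yang–Baxter equation. -/
theorem disjointUnion_isSolution_isTwoReductive
    {I : Type*} [Nonempty I] {A : I → Type*} [∀ i, AddCommGroup (A i)]
    (c d : ∀ i j : I, A j) :
    IsSolution (duσ c) (duτ d) ∧ IsTwoReductive (duσ c) (duτ d) := by
  refine ⟨⟨fun x => bijective_sigma_translation (c x.1),
    fun y => bijective_sigma_translation (d y.1), bijective_rmap_disjointUnion c d,
    braid_disjointUnion c d⟩, isTwoReductive_disjointUnion c d⟩

end YBE
end

section
/- Every 2-reductive solution (X,σ,τ) of the Yang–Baxter equation is a disjoint union of abelian groups: there exist an index set I, a family (A_i)_{i∈I} of additive abelian groups, and constants c_{i,j}, d_{i,j} ∈ A_j for all i,j ∈ I, with each A_j generated by the set {c_{i,j}, d_{i,j} : i ∈ I}, together with an isomorphism of solutions from (X,σ,τ) to the disjoint-union solution (⨆_{i∈I} A_i, σ', τ') where σ'_x(y) = y + c_{i,j} and τ'_y(x) = x + d_{j,i} for x ∈ A_i, y ∈ A_j. Moreover the images of the groups A_i under this isomorphism are exactly the orbits of the permutation group G(X) = ⟨σ_x, τ_x : x ∈ X⟩ acting on X. -/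
namespace YBE

variable {X : Type*}

universe u

open MulAction in
/-- A set acted on by a commutative group is a disjoint union of abelian groups, one for each
orbit, on which the group acts by translations. -/
theorem exists_equiv_sigma_of_commGroup_action {G X : Type u} [CommGroup G] [MulAction G X] :
    ∃ (A : orbitRel.Quotient G X → Type u) (_ : ∀ i, AddCommGroup (A i))
      (φ : ∀ i, Additive G →+ A i) (Φ : X ≃ Σ i, A i),
      (∀ i, Function.Surjective (φ i)) ∧
      (∀ x, (Φ x).1 = Quotient.mk'' x) ∧
      ∀ (g : G) (x : X), Φ (g • x) = ⟨(Φ x).1, (Φ x).2 + φ _ (Additive.ofMul g)⟩ := by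
  let A : orbitRel.Quotient G X → Type u := fun i => Additive (G ⧸ stabilizer G i.out)
  let φ : ∀ i, Additive G →+ A i := fun i =>
    MonoidHom.toAdditive (QuotientGroup.mk' (stabilizer G i.out))
  let Ψ : (Σ i, A i) → X := fun p => ofQuotientStabilizer G p.1.out p.2.toMul
  have hφ : ∀ i, Function.Surjective (φ i) := fun i =>
    QuotientGroup.mk'_surjective (stabilizer G i.out)
  have hmk : ∀ i g, Ψ ⟨i, φ i (Additive.ofMul g)⟩ = g • i.out := fun i g => rfl
  have hfst : ∀ p, (Quotient.mk'' (Ψ p) : orbitRel.Quotient G X) = p.1 := by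
    rintro ⟨i, a⟩
    obtain ⟨g, rfl⟩ := hφ i a
    refine Eq.trans (Quotient.sound' ?_) (Quotient.out_eq' i)
    exact ⟨g.toMul, rfl⟩
  have hsmul : ∀ (g : G) p, Ψ ⟨p.1, p.2 + φ _ (Additive.ofMul g)⟩ = g • Ψ p := by
    rintro g ⟨i, a⟩
    obtain ⟨h, rfl⟩ := hφ i a
    change (h.toMul * g) • i.out = g • h.toMul • i.out
    rw [mul_comm, mul_smul]
  have hbij : Function.Bijective Ψ := by
    constructor
    · rintro ⟨i, a⟩ ⟨j, b⟩ h
      obtain rfl : i = j := by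
        simpa only [hfst] using congrArg (Quotient.mk'' (s₁ := orbitRel G X)) h
      congr 1
      exact injective_ofQuotientStabilizer G i.out h
    · intro x
      have hx : orbitRel G X x (Quotient.mk'' x : orbitRel.Quotient G X).out :=
        Setoid.symm' _ (Quotient.mk_out' x)
      obtain ⟨g, hg⟩ := hx
      exact ⟨⟨Quotient.mk'' x, φ _ (Additive.ofMul g)⟩, hg⟩
  let Φ := (Equiv.ofBijective Ψ hbij).symm
  have hΨ : ∀ x, Ψ (Φ x) = x := (Equiv.ofBijective Ψ hbij).apply_symm_apply
  refine ⟨A, fun i => inferInstance, φ, Φ, hφ, fun x => ?_, fun g x => hbij.1 ?_⟩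
  · rw [← hfst, hΨ]
  · rw [hsmul, hΨ, hΨ]

/-- The braid relation of a 2-reductive solution says that all the maps `σ_x`, `τ_y` commute. -/
theorem IsTwoReductive.comm {σ τ : X → X → X} (h2r : IsTwoReductive σ τ)
    (hbraid : r23 σ τ ∘ r12 σ τ ∘ r23 σ τ = r12 σ τ ∘ r23 σ τ ∘ r12 σ τ) :
    (∀ x y z, σ x (σ y z) = σ y (σ x z)) ∧ (∀ x y z, τ x (τ y z) = τ y (τ x z)) ∧
      ∀ x y z, σ x (τ y z) = τ y (σ x z) := by
  obtain ⟨h1, h2, h3, h4⟩ := h2r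
  have key : ∀ x y z, σ x (σ y z) = σ y (σ x z) ∧ τ z (σ x y) = σ x (τ z y) ∧
      τ z (τ y x) = τ y (τ z x) := by
    intro x y z
    have h := congrFun hbraid (x, y, z)
    simp only [r23, r12, Function.comp_apply, Prod.mk.injEq, h1, h2, h3, h4] at h
    grind
  exact ⟨fun x y z => (key x y z).1, fun x y z => (key z y x).2.2,
    fun x y z => (key x z y).2.1.symm⟩


/-- every 2-reductive solution is (isomorphic to) a disjoint union
of abelian groups, with each `A_j` generated by the constants `c_{i,j}, d_{i,j}`,
and the groups corresponding exactly to the orbits of the permutation group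
`G(X) = ⟨σ_x, τ_x : x ∈ X⟩`. -/
theorem twoReductive_iso_disjointUnion {X : Type u} {σ τ : X → X → X}
    (hsol : IsSolution σ τ) (h2r : IsTwoReductive σ τ) :
    ∃ (I : Type u) (A : I → Type u) (inst : ∀ i, AddCommGroup (A i)),
      letI := inst
      ∃ (c d : ∀ i j : I, A j) (Φ : X ≃ (Σ i, A i)),
        (∀ j, AddSubgroup.closure
            ((Set.range fun i => c i j) ∪ (Set.range fun i => d i j)) = ⊤) ∧
        (∀ x y, Φ (σ x y) = duσ c (Φ x) (Φ y)) ∧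
        (∀ x y, Φ (τ x y) = duτ d (Φ x) (Φ y)) ∧
        (∀ x y : X, (Φ x).1 = (Φ y).1 ↔
          ∃ g ∈ Subgroup.closure
              ((Set.range fun x => Equiv.ofBijective (σ x) (hsol.1 x)) ∪
               (Set.range fun x => Equiv.ofBijective (τ x) (hsol.2.1 x))),
            g x = y) := by
  obtain ⟨hσσ, hττ, hστ⟩ := h2r.comm hsol.2.2.2
  obtain ⟨h1, h2, h3, h4⟩ := h2r
  let s : X → Equiv.Perm X := fun x => Equiv.ofBijective (σ x) (hsol.1 x)
  let t : X → Equiv.Perm X := fun x => Equiv.ofBijective (τ x) (hsol.2.1 x)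
  let G := Subgroup.closure (Set.range s ∪ Set.range t)
  have hs : ∀ x, s x ∈ G := fun x => Subgroup.subset_closure (.inl ⟨x, rfl⟩)
  have ht : ∀ x, t x ∈ G := fun x => Subgroup.subset_closure (.inr ⟨x, rfl⟩)
  have : IsMulCommutative G := Subgroup.isMulCommutative_closure <| by
    rintro _ (⟨x, rfl⟩ | ⟨x, rfl⟩) _ (⟨y, rfl⟩ | ⟨y, rfl⟩) <;> ext z
    exacts [hσσ x y z, hστ x y z, (hστ y x z).symm, hττ x y z]
  have hinv : ∀ g ∈ G, ∀ x, σ (g x) = σ x ∧ τ (g x) = τ x := by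
    intro g hg
    induction hg using Subgroup.closure_induction with
    | mem g hg =>
      rcases hg with ⟨y, rfl⟩ | ⟨y, rfl⟩
      · exact fun x => ⟨h1 y x, h4 y x⟩
      · exact fun x => ⟨h3 y x, h2 y x⟩
    | one => exact fun x => ⟨rfl, rfl⟩
    | mul g h _ _ ihg ihh =>
      exact fun x => ⟨(ihg (h x)).1.trans (ihh x).1, (ihg (h x)).2.trans (ihh x).2⟩
    | inv g _ ih =>
      intro x
      have := ih (g⁻¹ x)
      rw [← Equiv.Perm.mul_apply, mul_inv_cancel] at this
      exact ⟨this.1.symm, this.2.symm⟩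
  open scoped IsMulCommutative in
  obtain ⟨A, inst, φ, Φ, hφ, hfst, hsmul⟩ :=
    exists_equiv_sigma_of_commGroup_action (G := G) (X := X)
  have horbit : ∀ x y : X, (Φ x).1 = (Φ y).1 ↔ ∃ g ∈ G, g x = y := by
    intro x y
    rw [hfst, hfst, eq_comm, Quotient.eq'']
    exact ⟨fun ⟨g, hg⟩ => ⟨g, g.2, hg⟩, fun ⟨g, hg, hgx⟩ => ⟨⟨g, hg⟩, hgx⟩⟩
  have hout : ∀ x, σ (Φ x).1.out = σ x ∧ τ (Φ x).1.out = τ x := by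
    intro x
    obtain ⟨g, hg, hgx⟩ := (horbit x (Φ x).1.out).1 <| by
      rw [hfst (Quotient.out _)]
      exact (Quotient.out_eq' _).symm
    rw [← hgx]
    exact hinv g hg x
  refine ⟨_, A, inst, fun i j => φ j (.ofMul ⟨s i.out, hs _⟩),
    fun i j => φ j (.ofMul ⟨t i.out, ht _⟩), Φ, fun j => ?_, fun x y => ?_, fun x y => ?_, horbit⟩
  · rw [eq_top_iff]
    rintro a -
    obtain ⟨⟨g, hg⟩, rfl⟩ := hφ j a
    induction hg using Subgroup.closure_induction with
    | mem g hg =>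
      apply AddSubgroup.subset_closure
      rcases hg with ⟨x, rfl⟩ | ⟨x, rfl⟩
      · have : s (Φ x).1.out = s x := Equiv.ext fun z => congrFun (hout x).1 z
        exact .inl ⟨(Φ x).1, by simp only [this]; rfl⟩
      · have : t (Φ x).1.out = t x := Equiv.ext fun z => congrFun (hout x).2 z
        exact .inr ⟨(Φ x).1, by simp only [this]; rfl⟩
    | one => exact Set.mem_of_eq_of_mem (map_zero (φ j)) (zero_mem _)
    | mul g h hg hh ihg ihh =>
      exact Set.mem_of_eq_of_mem (map_add (φ j) (.ofMul ⟨g, hg⟩) (.ofMul ⟨h, hh⟩))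
        (add_mem ihg ihh)
    | inv g hg ih =>
      exact Set.mem_of_eq_of_mem (map_neg (φ j) (.ofMul ⟨g, hg⟩)) (neg_mem ih)
  · rw [← (hout x).1]
    exact hsmul ⟨s (Φ x).1.out, hs _⟩ y
  · rw [← (hout x).2]
    exact hsmul ⟨t (Φ x).1.out, ht _⟩ y

end YBE
end

section
/- Let 𝒜 = ((A_i)_{i∈I},(c_{i,j}),(d_{i,j})) and 𝒜' = ((A'_i)_{i∈I},(c'_{i,j}),(d'_{i,j})) be two disjoint unions of abelian groups over the same index set I, each satisfying the generation condition A_j = ⟨{c_{i,j}, d_{i,j} : i ∈ I}⟩ and A'_j = ⟨{c'_{i,j}, d'_{i,j} : i ∈ I}⟩ for every j ∈ I. Then the associated disjoint-union solutions (⨆_{i∈I} A_i,σ,τ) and (⨆_{i∈I} A'_i,σ',τ') are isomorphic as solutions if and only if there exist a bijection π of I and group isomorphisms ψ_i : A_i → A'_{π(i)} such that ψ_j(c_{i,j}) = c'_{π(i),π(j)} and ψ_j(d_{i,j}) = d'_{π(i),π(j)} for all i,j ∈ I. -/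
namespace YBE

variable {X : Type*}

section DisjointUnion

variable {I : Type*} {A A' : I → Type*}
  [∀ i, AddCommGroup (A i)] [∀ i, AddCommGroup (A' i)]

/-- A homomorphism of disjoint-union solutions maps every `A j` into a single component, provided
that the constants generate `A j`. -/
theorem fst_apply_eq_of_hom {c d : ∀ i j : I, A j} {c' d' : ∀ i j : I, A' j}
    (hgen : ∀ j, AddSubgroup.closure
        ((Set.range fun i => c i j) ∪ (Set.range fun i => d i j)) = ⊤)
    {f : (Σ i, A i) → (Σ i, A' i)}
    (hσ : ∀ x y, f (duσ c x y) = duσ c' (f x) (f y))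
    (hτ : ∀ x y, f (duτ d x y) = duτ d' (f x) (f y)) (j : I) (a : A j) :
    (f ⟨j, a⟩).1 = (f ⟨j, 0⟩).1 := by
  have key : ∀ g : A j, ∀ b : A j, (f ⟨j, b + g⟩).1 = (f ⟨j, b⟩).1 := by
    intro g
    have hg : g ∈ AddSubgroup.closure
        ((Set.range fun i => c i j) ∪ (Set.range fun i => d i j)) := hgen j ▸ AddSubgroup.mem_top g
    induction hg using AddSubgroup.closure_induction with
    | mem x hx =>
      intro b
      rcases hx with ⟨i, rfl⟩ | ⟨i, rfl⟩
      · have h := congrArg Sigma.fst (hσ ⟨i, 0⟩ ⟨j, b⟩)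
        exact h
      · have h := congrArg Sigma.fst (hτ ⟨i, 0⟩ ⟨j, b⟩)
        exact h
    | zero => simp
    | add x y _ _ hx hy => intro b; rw [← add_assoc, hy, hx]
    | neg x _ hx => intro b; simpa using (hx (b + -x)).symm
  simpa using key a 0

/-- A map that turns the translations by a generating set into translations is affine. -/
theorem map_add_eq_of_closure_eq_top {G H : Type*} [AddCommGroup G] [AddCommGroup H]
    {S : Set G} (hS : AddSubgroup.closure S = ⊤) {f : G → H}
    (hf : ∀ s ∈ S, ∃ t, ∀ a, f (a + s) = f a + t) (a b : G) :
    f (a + b) = f a + (f b - f 0) := by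
  have key : ∃ t, ∀ a, f (a + b) = f a + t := by
    have hb : b ∈ AddSubgroup.closure S := hS ▸ AddSubgroup.mem_top b
    induction hb using AddSubgroup.closure_induction with
    | mem x hx => exact hf x hx
    | zero => exact ⟨0, by simp⟩
    | add x y _ _ hx hy =>
      obtain ⟨s, hs⟩ := hx
      obtain ⟨t, ht⟩ := hy
      exact ⟨s + t, fun a => by rw [← add_assoc, ht, hs, add_assoc]⟩
    | neg x _ hx =>
      obtain ⟨s, hs⟩ := hx
      exact ⟨-s, fun a => by rw [eq_add_neg_iff_add_eq, ← hs, neg_add_cancel_right]⟩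
  obtain ⟨t, ht⟩ := key
  have h0 := ht 0
  rw [zero_add] at h0
  rw [ht, h0, add_sub_cancel_left]

/-- An isomorphism of disjoint-union solutions induces a permutation of the index set together with
isomorphisms of the groups carrying the constants to the constants. -/
theorem exists_addEquiv_of_iso {c d : ∀ i j : I, A j} {c' d' : ∀ i j : I, A' j}
    (hgen : ∀ j, AddSubgroup.closure
        ((Set.range fun i => c i j) ∪ (Set.range fun i => d i j)) = ⊤)
    (hgen' : ∀ j, AddSubgroup.closure
        ((Set.range fun i => c' i j) ∪ (Set.range fun i => d' i j)) = ⊤)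
    (Φ : (Σ i, A i) ≃ (Σ i, A' i))
    (hσ : ∀ x y, Φ (duσ c x y) = duσ c' (Φ x) (Φ y))
    (hτ : ∀ x y, Φ (duτ d x y) = duτ d' (Φ x) (Φ y)) :
    ∃ (π : Equiv.Perm I) (ψ : ∀ i, A i ≃+ A' (π i)),
      ∀ i j, ψ j (c i j) = c' (π i) (π j) ∧ ψ j (d i j) = d' (π i) (π j) := by
  have hσ' : ∀ x y, Φ.symm (duσ c' x y) = duσ c (Φ.symm x) (Φ.symm y) := fun x y => by
    simp [Equiv.symm_apply_eq, hσ]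
  have hτ' : ∀ x y, Φ.symm (duτ d' x y) = duτ d (Φ.symm x) (Φ.symm y) := fun x y => by
    simp [Equiv.symm_apply_eq, hτ]
  have hfst := fst_apply_eq_of_hom hgen hσ hτ
  have hfst' := fst_apply_eq_of_hom hgen' hσ' hτ'
  let π : Equiv.Perm I :=
    { toFun := fun i => (Φ ⟨i, 0⟩).1
      invFun := fun i => (Φ.symm ⟨i, 0⟩).1
      left_inv := fun i => by
        change (Φ.symm ⟨(Φ ⟨i, 0⟩).1, 0⟩).1 = i
        rw [← hfst' _ (Φ ⟨i, 0⟩).2, Sigma.eta, Equiv.symm_apply_apply]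
      right_inv := fun i => by
        change (Φ ⟨(Φ.symm ⟨i, 0⟩).1, 0⟩).1 = i
        rw [← hfst _ (Φ.symm ⟨i, 0⟩).2, Sigma.eta, Equiv.apply_symm_apply] }
  have hex : ∀ (j : I) (a : A j), ∃ b : A' (π j), Φ ⟨j, a⟩ = ⟨π j, b⟩ := by
    intro j a
    have h : (Φ ⟨j, a⟩).1 = π j := hfst j a
    rcases hΦ : Φ ⟨j, a⟩ with ⟨k, b⟩
    rw [hΦ] at h
    subst h
    exact ⟨b, rfl⟩
  choose φ hφ using hex
  have hc : ∀ i j a, φ j (a + c i j) = φ j a + c' (π i) (π j) := by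
    intro i j a
    have h : Φ ⟨j, a + c i j⟩ = _ := hσ ⟨i, 0⟩ ⟨j, a⟩
    rw [hφ, hφ, hφ] at h
    exact sigma_mk_injective h
  have hd : ∀ i j a, φ j (a + d i j) = φ j a + d' (π i) (π j) := by
    intro i j a
    have h : Φ ⟨j, a + d i j⟩ = _ := hτ ⟨i, 0⟩ ⟨j, a⟩
    rw [hφ, hφ, hφ] at h
    exact sigma_mk_injective h
  have hadd : ∀ j a b, φ j (a + b) = φ j a + (φ j b - φ j 0) := fun j =>
    map_add_eq_of_closure_eq_top (hgen j) <| by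
      rintro _ (⟨i, rfl⟩ | ⟨i, rfl⟩)
      exacts [⟨_, hc i j⟩, ⟨_, hd i j⟩]
  have hinj : ∀ j, Function.Injective (φ j) := fun j a b hab =>
    sigma_mk_injective (Φ.injective (by rw [hφ, hφ, hab]))
  have hsurj : ∀ j, Function.Surjective (φ j) := by
    intro j b
    obtain ⟨⟨k, a⟩, hka⟩ := Φ.surjective ⟨π j, b⟩
    rw [hφ] at hka
    obtain rfl : k = j := π.injective (congrArg Sigma.fst hka :)
    exact ⟨a, sigma_mk_injective hka⟩
  let ψ : ∀ j, A j ≃+ A' (π j) := fun j =>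
    AddEquiv.ofBijective
      (AddMonoidHom.mk' (fun a => φ j a - φ j 0) fun a b => by rw [hadd]; abel)
      ⟨fun a b hab => hinj j (sub_left_injective hab), fun b => by
        obtain ⟨a, ha⟩ := hsurj j (b + φ j 0)
        exact ⟨a, by simp [ha]⟩⟩
  refine ⟨π, ψ, fun i j => ⟨?_, ?_⟩⟩
  · change φ j (c i j) - φ j 0 = _
    rw [← zero_add (c i j), hc, add_sub_cancel_left]
  · change φ j (d i j) - φ j 0 = _
    rw [← zero_add (d i j), hd, add_sub_cancel_left]

end DisjointUnion

/-- two disjoint unions of abelian groups over the same index set,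
both satisfying the generation condition, are isomorphic as solutions if and
only if there is a bijection `π` of `I` and group isomorphisms
`ψ_i : A_i ≃+ A'_{π(i)}` carrying the constants to the constants. -/
theorem disjointUnion_iso_iff {I : Type*} {A A' : I → Type*}
    [∀ i, AddCommGroup (A i)] [∀ i, AddCommGroup (A' i)]
    (c d : ∀ i j : I, A j) (c' d' : ∀ i j : I, A' j)
    (hgen : ∀ j, AddSubgroup.closure
        ((Set.range fun i => c i j) ∪ (Set.range fun i => d i j)) = ⊤)
    (hgen' : ∀ j, AddSubgroup.closure
        ((Set.range fun i => c' i j) ∪ (Set.range fun i => d' i j)) = ⊤) :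
    (∃ Φ : (Σ i, A i) ≃ (Σ i, A' i),
        (∀ x y, Φ (duσ c x y) = duσ c' (Φ x) (Φ y)) ∧
        (∀ x y, Φ (duτ d x y) = duτ d' (Φ x) (Φ y))) ↔
    (∃ (π : Equiv.Perm I) (ψ : ∀ i, A i ≃+ A' (π i)),
        ∀ i j, ψ j (c i j) = c' (π i) (π j) ∧ ψ j (d i j) = d' (π i) (π j)) := by
  constructor
  · rintro ⟨Φ, hσ, hτ⟩
    exact exists_addEquiv_of_iso hgen hgen' Φ hσ hτ
  · rintro ⟨π, ψ, h⟩
    refine ⟨Equiv.sigmaCongr π fun i => (ψ i).toEquiv, ?_, ?_⟩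
    · rintro ⟨i, a⟩ ⟨j, b⟩
      exact congrArg (Sigma.mk (π j))
        (((ψ j).map_add b (c i j)).trans (congrArg (ψ j b + ·) (h i j).1))
    · rintro ⟨i, a⟩ ⟨j, b⟩
      exact congrArg (Sigma.mk (π j))
        (((ψ j).map_add b (d i j)).trans (congrArg (ψ j b + ·) (h i j).2))

end YBE
end

section
/- Let (X,σ,τ) be a solution of the Yang–Baxter equation. Then: (i) if σ_{σ_x(y)}=σ_y and σ_{τ_x(y)}=σ_y hold for all x,y ∈ X, then σ_xσ_y = σ_yσ_x for all x,y ∈ X (the left permutation group is abelian); (ii) if τ_{τ_x(y)}=τ_y and τ_{σ_x(y)}=τ_y hold for all x,y ∈ X, then τ_xτ_y = τ_yτ_x for all x,y ∈ X (the right permutation group is abelian); (iii) if (X,σ,τ) is 2-reductive, then additionally σ_xτ_z = τ_zσ_x for all x,z ∈ X, so the full permutation group ⟨σ_x, τ_x : x ∈ X⟩ is abelian. -/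
namespace YBE

variable {X : Type*}

theorem IsSolution.sigma_comp {X : Type*} {σ τ : X → X → X} (hsol : IsSolution σ τ)
    (x y z : X) : σ x (σ y z) = σ (σ x y) (σ (τ y x) z) :=
  congrArg Prod.fst (congrFun hsol.2.2.2 (x, y, z))

theorem IsSolution.sigma_tau {X : Type*} {σ τ : X → X → X} (hsol : IsSolution σ τ)
    (x y z : X) : σ (τ (σ y z) x) (τ z y) = τ (σ (τ y x) z) (σ x y) :=
  congrArg (fun p => p.2.1) (congrFun hsol.2.2.2 (x, y, z))

theorem IsSolution.tau_comp {X : Type*} {σ τ : X → X → X} (hsol : IsSolution σ τ)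
    (x y z : X) : τ (τ z y) (τ (σ y z) x) = τ z (τ y x) :=
  congrArg (fun p => p.2.2) (congrFun hsol.2.2.2 (x, y, z))

/-- (i) identities (2.1) and (2.3) force the `σ`'s to commute,
(ii) identities (2.2) and (2.4) force the `τ`'s to commute, (iii) 2-reductivity
forces the whole permutation group to be abelian. -/
theorem twoReductive_permutationGroup_abelian {X : Type*} {σ τ : X → X → X}
    (hsol : IsSolution σ τ) :
    (((∀ x y, σ (σ x y) = σ y) ∧ (∀ x y, σ (τ x y) = σ y)) →
        ∀ x y z, σ x (σ y z) = σ y (σ x z)) ∧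
    (((∀ x y, τ (τ x y) = τ y) ∧ (∀ x y, τ (σ x y) = τ y)) →
        ∀ x y z, τ x (τ y z) = τ y (τ x z)) ∧
    (IsTwoReductive σ τ →
        (∀ x y z, σ x (σ y z) = σ y (σ x z)) ∧
        (∀ x y z, τ x (τ y z) = τ y (τ x z)) ∧
        (∀ x z y, σ x (τ z y) = τ z (σ x y))) := by
  have hσ : ((∀ x y, σ (σ x y) = σ y) ∧ (∀ x y, σ (τ x y) = σ y)) →
      ∀ x y z, σ x (σ y z) = σ y (σ x z) := by
    rintro ⟨h1, h2⟩ x y z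
    rw [hsol.sigma_comp x y z, h1, h2]
  have hτ : ((∀ x y, τ (τ x y) = τ y) ∧ (∀ x y, τ (σ x y) = τ y)) →
      ∀ x y z, τ x (τ y z) = τ y (τ x z) := by
    rintro ⟨h1, h2⟩ x y z
    rw [← hsol.tau_comp z y x, h1, h2]
  refine ⟨hσ, hτ, fun ⟨hσσ, hττ, hστ, hτσ⟩ => ⟨hσ ⟨hσσ, hστ⟩, hτ ⟨hττ, hτσ⟩, fun x z y => ?_⟩⟩
  simpa only [hστ, hτσ] using hsol.sigma_tau x y z

end YBE
end

section
/- A 2-reductive solution (X,σ,τ) of the Yang–Baxter equation satisfies σ_x = τ_x⁻¹ for all x ∈ X if and only if it is involutive, i.e. r∘r = id on X×X where r(x,y)=(σ_x(y),τ_y(x)). -/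
namespace YBE

variable {X : Type*}

/-- a 2-reductive solution satisfies `σ_x = τ_x⁻¹` for all `x`
if and only if it is involutive (`r ∘ r = id`). -/
theorem twoReductive_lri_iff_involutive {X : Type*} {σ τ : X → X → X}
    (hsol : IsSolution σ τ) (h2r : IsTwoReductive σ τ) :
    (∀ x y, σ x (τ x y) = y ∧ τ x (σ x y) = y) ↔ rmap σ τ ∘ rmap σ τ = id := by
  obtain ⟨hσσ, hττ, -, -⟩ := h2r
  have hrr (x y : X) : (rmap σ τ ∘ rmap σ τ) (x, y) = (σ y (τ y x), τ x (σ x y)) := by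
    simp only [Function.comp_apply, rmap, hσσ, hττ]
  constructor
  · intro h
    funext ⟨x, y⟩
    rw [hrr, (h y x).1, (h x y).2, id]
  · intro h x y
    have hid (a b : X) : (σ b (τ b a), τ a (σ a b)) = (a, b) := by rw [← hrr, h, id]
    exact ⟨congrArg Prod.fst (hid y x), congrArg Prod.snd (hid x y)⟩

end YBE
end

section
/- Let (X,σ,τ) be the disjoint-union solution of ((A_i)_{i∈I},(c_{i,j}),(d_{i,j})). If (X,σ,τ) is injective (the canonical map from X to its structure group G(X,r) is injective), then c_{i,i} = −d_{i,i} for every i ∈ I; equivalently, σ_x⁻¹(x) = τ_x(x) for every x ∈ X. -/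
namespace YBE

variable {X : Type*}

/-- The relations `x ∘ y = σ_x(y) ∘ τ_y(x)` presenting the structure group of a
solution. -/
def structureRels {X : Type*} (σ τ : X → X → X) : Set (FreeGroup X) :=
  {w | ∃ x y, w = (FreeGroup.of x * FreeGroup.of y) *
      (FreeGroup.of (σ x y) * FreeGroup.of (τ y x))⁻¹}

/-- A solution is injective if the canonical map to its structure group
`G(X,r) = ⟨X | x∘y = σ_x(y)∘τ_y(x)⟩` is injective. -/
def IsInjectiveSolution {X : Type*} (σ τ : X → X → X) : Prop :=
  Function.Injective fun x : X =>
    (PresentedGroup.of x : PresentedGroup (structureRels σ τ))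

/-- The defining relations hold in the structure group. -/
theorem of_mul_of {X : Type*} (σ τ : X → X → X) (x y : X) :
    (PresentedGroup.of x * PresentedGroup.of y : PresentedGroup (structureRels σ τ)) =
      PresentedGroup.of (σ x y) * PresentedGroup.of (τ y x) := by
  have h : PresentedGroup.mk (structureRels σ τ) _ = 1 :=
    PresentedGroup.one_of_mem ⟨x, y, rfl⟩
  rwa [map_mul, map_inv, mul_inv_eq_one, map_mul, map_mul] at h

/-- if the disjoint-union solution is injective then
`c_{i,i} = −d_{i,i}` for every `i`. -/
theorem disjointUnion_injective_diag {I : Type*} {A : I → Type*}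
    [∀ i, AddCommGroup (A i)] (c d : ∀ i j : I, A j)
    (hinj : IsInjectiveSolution (duσ c) (duτ d)) :
    ∀ i, c i i = -(d i i) := by
  intro i
  have h := of_mul_of (duσ c) (duτ d) ⟨i, 0⟩ ⟨i, -c i i⟩
  have hσ : duσ c ⟨i, 0⟩ ⟨i, -c i i⟩ = ⟨i, 0⟩ := by simp [duσ]
  rw [hσ] at h
  have hx := hinj (mul_left_cancel h)
  have hneg : -c i i = d i i := by simpa [duτ] using hx
  rw [← hneg, neg_neg]

end YBE
end

section
/- Let (X,σ,τ) be the disjoint-union solution of ((A_i)_{i∈I},(c_{i,j}),(d_{i,j})). If (X,σ,τ) is injective (the canonical map from X to its structure group G(X,r) is injective), then for all i,j ∈ I the additive order of c_{i,j} + d_{i,j} in A_j equals the additive order of c_{j,i} + d_{j,i} in A_i. -/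
namespace YBE

variable {X : Type*}

section StructureGroup

variable {I : Type*} {A : I → Type*} [∀ i, AddCommGroup (A i)] (c d : ∀ i j : I, A j)

/-- The generator of the structure group of the disjoint-union solution given by `a ∈ A_i`. -/
def duGen (i : I) (a : A i) : PresentedGroup (structureRels (duσ c) (duτ d)) :=
  PresentedGroup.of ⟨i, a⟩

theorem duGen_mul_swap {i j : I} (a : A i) (b : A j) :
    duGen c d i a * duGen c d j b = duGen c d j (b + c i j) * duGen c d i (a + d j i) := by
  have h := PresentedGroup.one_of_mem (rels := structureRels (duσ c) (duτ d))
    ⟨⟨i, a⟩, ⟨j, b⟩, rfl⟩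
  rw [map_mul, map_inv, mul_inv_eq_one, map_mul, map_mul] at h
  exact h

theorem duGen_mul_nsmul {i j : I} (n : ℕ) (a : A i) (b : A j) :
    duGen c d i a * duGen c d j b =
      duGen c d i (a + n • (c j i + d j i)) * duGen c d j (b + n • (c i j + d i j)) := by
  induction n with
  | zero => simp
  | succ n ih =>
    rw [ih, duGen_mul_swap, duGen_mul_swap]
    congr 2 <;> rw [succ_nsmul] <;> abel

variable {c d} in
theorem nsmul_eq_zero_of_injective (hinj : IsInjectiveSolution (duσ c) (duτ d)) {i j : I} {n : ℕ}
    (h : n • (c i j + d i j) = 0) : n • (c j i + d j i) = 0 := by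
  have key := duGen_mul_nsmul c d n (0 : A i) (0 : A j)
  rw [h, add_zero, mul_left_inj, zero_add] at key
  exact (sigma_mk_injective (hinj key)).symm

end StructureGroup

/-- if the disjoint-union solution is injective then the additive
order of `c_{i,j} + d_{i,j}` equals the additive order of `c_{j,i} + d_{j,i}`. -/
theorem disjointUnion_injective_orders {I : Type*} {A : I → Type*}
    [∀ i, AddCommGroup (A i)] (c d : ∀ i j : I, A j)
    (hinj : IsInjectiveSolution (duσ c) (duτ d)) :
    ∀ i j, addOrderOf (c i j + d i j) = addOrderOf (c j i + d j i) := by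
  intro i j
  exact Nat.dvd_antisymm
    (addOrderOf_dvd_of_nsmul_eq_zero
      (nsmul_eq_zero_of_injective hinj (addOrderOf_nsmul_eq_zero _)))
    (addOrderOf_dvd_of_nsmul_eq_zero
      (nsmul_eq_zero_of_injective hinj (addOrderOf_nsmul_eq_zero _)))

end YBE
end

section
/- A solution (X,σ,τ) of the Yang–Baxter equation is left distributive (σ_xσ_y = σ_{σ_x(y)}σ_x for all x,y ∈ X) if and only if its inverse solution (X,σ̂,τ̂) is right distributive (τ̂_xτ̂_y = τ̂_{τ̂_x(y)}τ̂_x for all x,y ∈ X). -/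
namespace YBE

variable {X : Type*}

theorem rmap_comp_eq_id_iff {X : Type*} {σ τ σ' τ' : X → X → X} :
    rmap σ τ ∘ rmap σ' τ' = id ↔
      ∀ x y, σ (σ' x y) (τ' y x) = x ∧ τ (τ' y x) (σ' x y) = y := by
  simp [funext_iff, rmap]

/-- The inverse of a map satisfying the braid relation satisfies it as well. -/
theorem braid_inverse {X : Type*} {σ τ σ' τ' : X → X → X}
    (hbraid : r23 σ τ ∘ r12 σ τ ∘ r23 σ τ = r12 σ τ ∘ r23 σ τ ∘ r12 σ τ)
    (hinv1 : rmap σ τ ∘ rmap σ' τ' = id) (hinv2 : rmap σ' τ' ∘ rmap σ τ = id) :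
    r23 σ' τ' ∘ r12 σ' τ' ∘ r23 σ' τ' = r12 σ' τ' ∘ r23 σ' τ' ∘ r12 σ' τ' := by
  rw [rmap_comp_eq_id_iff] at hinv1 hinv2
  have h12 : ∀ p, r12 σ τ (r12 σ' τ' p) = p := fun p => by simp [r12, hinv1]
  have h23 : ∀ p, r23 σ τ (r23 σ' τ' p) = p := fun p => by simp [r23, hinv1]
  have i12 : Function.LeftInverse (r12 σ' τ') (r12 σ τ) := fun p => by simp [r12, hinv2]
  have i23 : Function.LeftInverse (r23 σ' τ') (r23 σ τ) := fun p => by simp [r23, hinv2]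
  funext p
  apply (i23.injective.comp (i12.injective.comp i23.injective))
  trans p
  · simp [h12, h23]
  · rw [hbraid]
    simp [h12, h23]

/-- The first component of the braid relation. -/
theorem braid_left {X : Type*} {σ τ : X → X → X}
    (hbraid : r23 σ τ ∘ r12 σ τ ∘ r23 σ τ = r12 σ τ ∘ r23 σ τ ∘ r12 σ τ) (x y z : X) :
    σ x (σ y z) = σ (σ x y) (σ (τ y x) z) :=
  congrArg Prod.fst (congrFun hbraid (x, y, z))

/-- The third component of the braid relation. -/
theorem braid_right {X : Type*} {σ τ : X → X → X}
    (hbraid : r23 σ τ ∘ r12 σ τ ∘ r23 σ τ = r12 σ τ ∘ r23 σ τ ∘ r12 σ τ) (x y z : X) :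
    τ x (τ y z) = τ (τ x y) (τ (σ y x) z) :=
  (congrArg (fun p => p.2.2) (congrFun hbraid (z, y, x))).symm

/-- a solution is left distributive iff its inverse solution
`(X, σ', τ')` is right distributive. -/
theorem left_distributive_iff_inverse_right_distributive
    {X : Type*} {σ τ σ' τ' : X → X → X}
    (hsol : IsSolution σ τ)
    (hinv1 : rmap σ τ ∘ rmap σ' τ' = id)
    (hinv2 : rmap σ' τ' ∘ rmap σ τ = id) :
    (∀ x y z, σ x (σ y z) = σ (σ x y) (σ x z)) ↔
    (∀ x y z, τ' x (τ' y z) = τ' (τ' x y) (τ' x z)) := by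
  obtain ⟨hσ, hτ, -, hbraid⟩ := hsol
  have hbraid' := braid_inverse hbraid hinv1 hinv2
  rw [rmap_comp_eq_id_iff] at hinv1 hinv2
  constructor
  · intro hld
    have hστ : ∀ x y, σ (τ y x) = σ x := fun x y => funext fun z =>
      (hσ (σ x y)).1 ((braid_left hbraid x y z).symm.trans (hld x y z))
    have hσσ' : ∀ x y, σ (σ' x y) = σ y := fun x y => by
      rw [← hστ (σ' x y) (τ' y x), (hinv1 x y).2]
    have hστ' : ∀ x y, σ y (τ' y x) = x := fun x y => by
      rw [← hσσ' x y, (hinv1 x y).1]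
    have hτ'σ' : ∀ x y, τ' (σ' x y) = τ' y := fun x y => funext fun z =>
      (hσ y).1 (by rw [hστ', ← hσσ' x y, hστ'])
    intro x y z
    rw [braid_right hbraid' x y z, hτ'σ']
  · intro hrd
    have hτ'inj : ∀ y, Function.Injective (τ' y) := fun y u v huv => by
      have hσ'uv : σ' u y = σ' v y := (hτ (τ' y u)).1 (by
        rw [(hinv1 u y).2, huv, (hinv1 v y).2])
      rw [← (hinv1 u y).1, ← (hinv1 v y).1, huv, hσ'uv]
    have hτ'σ' : ∀ x y, τ' (σ' x y) = τ' y := fun x y => funext fun z =>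
      hτ'inj (τ' y x) ((braid_right hbraid' y x z).symm.trans (hrd y x z))
    have hτ'τ : ∀ a b, τ' (τ b a) = τ' a := fun a b => by
      rw [← hτ'σ' (σ a b) (τ b a), (hinv2 a b).1]
    have hτ'σ : ∀ a b, τ' a (σ a b) = b := fun a b => by
      rw [← hτ'τ a b, (hinv2 a b).2]
    have hστ : ∀ x y, σ (τ y x) = σ x := fun x y => funext fun z =>
      hτ'inj x (by rw [hτ'σ, ← hτ'τ x y, hτ'σ])
    intro x y z
    rw [braid_left hbraid x y z, hστ]

end YBE
end

section
/- Let (X,σ,τ) be a left distributive solution of the Yang–Baxter equation (σ_xσ_y = σ_{σ_x(y)}σ_x for all x,y ∈ X), with inverse solution (X,σ̂,τ̂). Then for all x,y ∈ X one has τ_yτ_x = τ_{τ̂_y(x)}τ_{σ̂_x(y)}. -/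
namespace YBE

variable {X : Type*}

/-- in a left distributive solution,
`τ_y τ_x = τ_{τ̂_y(x)} τ_{σ̂_x(y)}`, where `(X, σ', τ')` is the inverse
solution. -/
theorem left_distributive_tau_identity {X : Type*} {σ τ σ' τ' : X → X → X}
    (hsol : IsSolution σ τ)
    (hinv1 : rmap σ τ ∘ rmap σ' τ' = id)
    (hinv2 : rmap σ' τ' ∘ rmap σ τ = id)
    (hld : ∀ x y z, σ x (σ y z) = σ (σ x y) (σ x z)) :
    ∀ x y z, τ y (τ x z) = τ (τ' y x) (τ (σ' x y) z) := by
  intro x y z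
  have hbraid : ∀ a b c, τ c (τ b a) = τ (τ c b) (τ (σ b c) a) := fun a b c =>
    (congrArg (fun p => p.2.2) (congrFun hsol.2.2.2 (a, b, c))).symm
  have hr : (σ (σ' x y) (τ' y x), τ (τ' y x) (σ' x y)) = (x, y) := congrFun hinv1 (x, y)
  have hx : σ (σ' x y) (τ' y x) = x := congrArg Prod.fst hr
  have hy : τ (τ' y x) (σ' x y) = y := congrArg Prod.snd hr
  rw [hbraid z (σ' x y) (τ' y x), hx, hy]

end YBE
end

section
/- Let (B,·,∘) be a skew left brace whose associated solution (B,λ,ρ) is right distributive, i.e. ρ_xρ_y = ρ_{ρ_x(y)}ρ_x for all x,y ∈ B. Then: (i) ρ_y(x) = ȳ∘(x·y) for all x,y ∈ B; (ii) for every x ∈ B, the map ρ_x is an automorphism of the group (B,·), i.e. ρ_x(a·b) = ρ_x(a)·ρ_x(b) for all a,b ∈ B. -/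
/-- A skew left brace: two group operations `·` (mul) and `∘` (circ) on `B`
sharing the neutral element `1`, satisfying
`a ∘ (b · c) = (a ∘ b) · a⁻¹ · (a ∘ c)`. -/
structure SkewLeftBrace (B : Type*) where
  mul : B → B → B
  one : B
  inv : B → B
  circ : B → B → B
  oinv : B → B
  mul_assoc : ∀ a b c, mul (mul a b) c = mul a (mul b c)
  one_mul : ∀ a, mul one a = a
  mul_one : ∀ a, mul a one = a
  inv_mul : ∀ a, mul (inv a) a = one
  mul_inv : ∀ a, mul a (inv a) = one
  circ_assoc : ∀ a b c, circ (circ a b) c = circ a (circ b c)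
  one_circ : ∀ a, circ one a = a
  circ_one : ∀ a, circ a one = a
  oinv_circ : ∀ a, circ (oinv a) a = one
  circ_oinv : ∀ a, circ a (oinv a) = one
  compat : ∀ a b c, circ a (mul b c) = mul (mul (circ a b) (inv a)) (circ a c)

namespace SkewLeftBrace

variable {B : Type*}

/-- `λ_a(b) = a⁻¹ · (a ∘ b)`. -/
def lam (S : SkewLeftBrace B) (a b : B) : B := S.mul (S.inv a) (S.circ a b)

/-- `ρ_b(a) = (λ_a(b))‾ ∘ a ∘ b`, so that `(B, lam, rho)` is the solution
associated to the skew left brace. -/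
def rho (S : SkewLeftBrace B) (b a : B) : B :=
  S.circ (S.circ (S.oinv (S.lam a b)) a) b

/-- `(B, ·, ∘)` is a bi-skew left brace: `(B, ∘, ·)` is also a skew left brace,
i.e. `a · (b ∘ c) = (a · b) ∘ ā ∘ (a · c)`. -/
def IsBiSkew (S : SkewLeftBrace B) : Prop :=
  ∀ a b c, S.mul a (S.circ b c) =
    S.circ (S.circ (S.mul a b) (S.oinv a)) (S.mul a c)


variable {B : Type*}

theorem inv_mul_cancel_left (S : SkewLeftBrace B) (a b : B) :
    S.mul (S.inv a) (S.mul a b) = b := by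
  rw [← S.mul_assoc, S.inv_mul, S.one_mul]

theorem mul_inv_cancel_left (S : SkewLeftBrace B) (a b : B) :
    S.mul a (S.mul (S.inv a) b) = b := by
  rw [← S.mul_assoc, S.mul_inv, S.one_mul]

theorem oinv_circ_cancel_left (S : SkewLeftBrace B) (a b : B) :
    S.circ (S.oinv a) (S.circ a b) = b := by
  rw [← S.circ_assoc, S.oinv_circ, S.one_circ]

theorem circ_oinv_cancel_left (S : SkewLeftBrace B) (a b : B) :
    S.circ a (S.circ (S.oinv a) b) = b := by
  rw [← S.circ_assoc, S.circ_oinv, S.one_circ]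

theorem mul_lam (S : SkewLeftBrace B) (a b : B) : S.mul a (S.lam a b) = S.circ a b :=
  S.mul_inv_cancel_left _ _

theorem lam_mul (S : SkewLeftBrace B) (a b c : B) :
    S.lam a (S.mul b c) = S.mul (S.lam a b) (S.lam a c) := by
  simp only [lam, S.compat, S.mul_assoc]

theorem lam_circ (S : SkewLeftBrace B) (a b c : B) :
    S.lam (S.circ a b) c = S.lam a (S.lam b c) := by
  have h : S.mul (S.circ a b) (S.lam a (S.lam b c)) = S.circ (S.circ a b) c := by
    rw [S.circ_assoc, ← S.mul_lam a b, S.mul_assoc, ← S.lam_mul, S.mul_lam, S.mul_lam]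
  rw [lam, ← h, S.inv_mul_cancel_left]

theorem one_lam (S : SkewLeftBrace B) (a : B) : S.lam S.one a = a := by
  rw [← S.one_mul (S.lam S.one a), S.mul_lam, S.one_circ]

theorem lam_circ_rho (S : SkewLeftBrace B) (a b : B) :
    S.circ (S.lam a b) (S.rho b a) = S.circ a b := by
  rw [rho, S.circ_assoc, S.circ_oinv_cancel_left]

theorem lam_circ_right (S : SkewLeftBrace B) (x a b : B) :
    S.lam x (S.circ a b) = S.circ (S.lam x a) (S.lam (S.rho a x) b) := by
  rw [← S.mul_lam (S.lam x a), ← S.lam_circ, S.lam_circ_rho, S.lam_circ, ← S.lam_mul, S.mul_lam]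

theorem circ_left_cancel (S : SkewLeftBrace B) {a b c : B} (h : S.circ a b = S.circ a c) :
    b = c := by
  rw [← S.oinv_circ_cancel_left a b, h, S.oinv_circ_cancel_left]

theorem rho_circ (S : SkewLeftBrace B) (a b x : B) :
    S.rho (S.circ a b) x = S.rho b (S.rho a x) := by
  apply S.circ_left_cancel (a := S.lam x (S.circ a b))
  rw [S.lam_circ_rho, S.lam_circ_right, S.circ_assoc, S.lam_circ_rho,
    ← S.circ_assoc (S.lam x a), S.lam_circ_rho, S.circ_assoc]

theorem rho_one (S : SkewLeftBrace B) (x : B) : S.rho S.one x = x := by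
  rw [rho, lam, S.circ_one, S.circ_one, S.inv_mul]
  simpa only [S.one_circ] using S.oinv_circ_cancel_left S.one x

theorem rho_injective (S : SkewLeftBrace B) (a : B) : Function.Injective (S.rho a) :=
  Function.LeftInverse.injective (g := S.rho (S.oinv a)) fun x => by
    rw [← S.rho_circ, S.circ_oinv, S.rho_one]

/-- In a right distributive solution, `ρ` is constant along the orbits of `λ`. -/
theorem rho_lam_of_right_distributive (S : SkewLeftBrace B)
    (hrd : ∀ x y z, S.rho x (S.rho y z) = S.rho (S.rho x y) (S.rho x z)) (x y z : B) :
    S.rho (S.lam y z) x = S.rho z x := by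
  apply S.rho_injective (S.rho z y)
  rw [← hrd, ← S.rho_circ, ← S.rho_circ, S.lam_circ_rho]

theorem oinv_circ_mul (S : SkewLeftBrace B) (x y : B) :
    S.circ (S.oinv y) (S.mul x y) =
      S.mul (S.mul (S.oinv y) (S.lam (S.oinv y) x)) (S.inv (S.oinv y)) := by
  rw [S.compat, S.oinv_circ, S.mul_one, S.mul_lam]

/-- if the associated solution of a skew left brace is right
distributive, then `ρ_y(x) = ȳ ∘ (x · y)` and every `ρ_x` is an automorphism of
the group `(B,·)`. -/
theorem rho_of_right_distributive (S : SkewLeftBrace B)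
    (hrd : ∀ x y z, S.rho x (S.rho y z) = S.rho (S.rho x y) (S.rho x z)) :
    (∀ x y, S.rho y x = S.circ (S.oinv y) (S.mul x y)) ∧
    (∀ x a b, S.rho x (S.mul a b) = S.mul (S.rho x a) (S.rho x b)) := by
  have hrho : ∀ x y, S.rho y x = S.circ (S.oinv y) (S.mul x y) := by
    intro x y
    have hy : S.lam x (S.lam (S.oinv x) y) = y := by
      rw [← S.lam_circ, S.circ_oinv, S.one_lam]
    rw [← hy, S.rho_lam_of_right_distributive hrd, S.mul_lam, rho, S.circ_assoc]
  refine ⟨hrho, fun x a b => ?_⟩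
  simp only [hrho, S.oinv_circ_mul, S.lam_mul]
  simp only [S.mul_assoc, S.inv_mul_cancel_left]
end SkewLeftBrace
end

section
/- Let (B,·,∘) be a skew left brace whose associated solution (B,λ,ρ) is 2-reductive. Then the group (B,·) is nilpotent of class at most 2; equivalently, every commutator x⁻¹·y⁻¹·x·y lies in the center of (B,·). -/
namespace SkewLeftBrace

variable {B : Type*}

variable {B : Type*}

/-- The group `(B, ·)` of a skew left brace. -/
abbrev mulGroup (S : SkewLeftBrace B) : Group B where
  mul := S.mul
  one := S.one
  inv := S.inv
  mul_assoc := S.mul_assoc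
  one_mul := S.one_mul
  mul_one := S.mul_one
  inv_mul_cancel := S.inv_mul

theorem lam_lam_oinv (S : SkewLeftBrace B) (a b : B) : S.lam a (S.lam (S.oinv a) b) = b := by
  rw [← S.lam_circ, S.circ_oinv, ← S.one_mul (S.lam S.one b), S.mul_lam, S.one_circ]

theorem lam_lam_rho (S : SkewLeftBrace B) (a b : B) :
    S.lam (S.lam a b) (S.rho b a) =
      S.mul (S.inv (S.lam a b)) (S.mul a (S.lam a b)) := by
  rw [S.mul_lam, ← S.lam_circ_rho]
  rfl

/-- if the associated solution of a skew left brace is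
2-reductive, then the group `(B,·)` is nilpotent of class at most 2: every
commutator `x⁻¹·y⁻¹·x·y` is central. -/
theorem mul_group_nilpotent_of_twoReductive (S : SkewLeftBrace B)
    (h2r : (∀ x y, S.lam (S.lam x y) = S.lam y) ∧
           (∀ x y, S.rho (S.rho x y) = S.rho y) ∧
           (∀ x y, S.lam (S.rho x y) = S.lam y) ∧
           (∀ x y, S.rho (S.lam x y) = S.rho y)) :
    ∀ x y z,
      S.mul (S.mul (S.mul (S.mul (S.inv x) (S.inv y)) x) y) z =
      S.mul z (S.mul (S.mul (S.mul (S.inv x) (S.inv y)) x) y) := by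
  obtain ⟨hll, hrr, hlr, hrl⟩ := h2r
  have lam_comm (x y z : B) : S.lam x (S.lam y z) = S.lam y (S.lam x z) := by
    rw [← S.lam_circ, ← S.lam_circ_rho, S.lam_circ, hll, hlr]
  have lam_rho (a b : B) : S.lam b (S.rho b a) =
      S.mul (S.inv (S.lam a b)) (S.mul a (S.lam a b)) := by
    rw [← S.lam_lam_rho, hll]
  have conj_lam (x c a : B) : S.mul (S.inv (S.lam x c)) (S.mul a (S.lam x c)) =
      S.mul (S.inv c) (S.mul a c) := by
    have h := lam_rho a (S.lam x (S.lam (S.oinv a) c))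
    rw [hrl, hll, lam_rho, lam_comm a x, S.lam_lam_oinv] at h
    exact h.symm
  have conj_rho (x y a : B) : S.mul (S.inv (S.rho x y)) (S.mul a (S.rho x y)) =
      S.mul (S.inv y) (S.mul a y) := by
    have h := lam_rho a (S.rho x y)
    rw [hrr, hlr, lam_rho, conj_lam, conj_lam] at h
    exact h.symm
  intro x y z
  let _ := S.mulGroup
  have h := conj_rho x y (y * z * y⁻¹)
  rw [← conj_lam x, lam_rho, conj_lam] at h
  change (x⁻¹ * (y * x))⁻¹ * (y * z * y⁻¹ * (x⁻¹ * (y * x))) = y⁻¹ * (y * z * y⁻¹ * y) at h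
  change x⁻¹ * y⁻¹ * x * y * z = z * (x⁻¹ * y⁻¹ * x * y)
  calc x⁻¹ * y⁻¹ * x * y * z
      = (x⁻¹ * (y * x))⁻¹ * (y * z * y⁻¹ * (x⁻¹ * (y * x))) * (x⁻¹ * y⁻¹ * x * y) := by group
    _ = z * (x⁻¹ * y⁻¹ * x * y) := by rw [h]; group
end SkewLeftBrace
end
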